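/- Let G = (V, E) be a finite simple undirected graph and let E' ⊆ E. Let N(G) denote the number of edge sets F on V with (V, F) isomorphic to G, and let N(G − E') denote the number of edge sets F' on V with (V, F') isomorphic to G − E' = (V, E ∖ E'). Then N(G) · |AO_G(E')| = N(G − E') · |AO_{G−E'}(E')|. -/

import Mathlib

/-- The set of automorphisms of a simple graph `G`: permutations `σ` of the
vertex set with `(a,b) ∈ E ↔ (σ a, σ b) ∈ E`. -/
def autSet {V : Type*} (G : SimpleGraph V) : Set (Equiv.Perm V) :=
  {σ | ∀ a b : V, G.Adj a b ↔ G.Adj (σ a) (σ b)}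

/-- The image of a set of unordered pairs under a permutation of the vertices. -/
def pairSetMap {V : Type*} (σ : Equiv.Perm V) (S : Set (Sym2 V)) : Set (Sym2 V) :=
  (Sym2.map σ) '' S

/-- The automorphism orbit of a set `S` of unordered vertex pairs in `G`:
`AO_G(S) = { σ(S) : σ ∈ Aut(G) }`. -/
def edgeSetOrbit {V : Type*} (G : SimpleGraph V) (S : Set (Sym2 V)) : Set (Set (Sym2 V)) :=
  {T | ∃ σ ∈ autSet G, pairSetMap σ S = T}

/-- The automorphism orbit of a vertex `v` in `G`: `AO_G(v) = { σ v : σ ∈ Aut(G) }`. -/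
def vertexOrbit {V : Type*} (G : SimpleGraph V) (v : V) : Set V :=
  {u | ∃ σ ∈ autSet G, σ v = u}

/-- `F` is an edge set on `V` forming a graph isomorphic to `G` (via a bijection of
the common vertex set carrying the edge set of `G` exactly onto `F`). -/
def isIsoEdgeSet {V : Type*} (G : SimpleGraph V) (F : Set (Sym2 V)) : Prop :=
  ∃ σ : Equiv.Perm V, pairSetMap σ G.edgeSet = F

/-- The action of vertex permutations on sets of unordered vertex pairs. -/
@[reducible] def pairSetMulAction (V : Type*) : MulAction (Equiv.Perm V) (Set (Sym2 V)) where
  smul := pairSetMap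
  one_smul S := by
    change Sym2.map id '' S = S
    simp
  mul_smul σ τ S := by
    change Sym2.map (σ ∘ τ) '' S = Sym2.map σ '' (Sym2.map τ '' S)
    rw [Set.image_image]
    simp only [Sym2.map_map]

theorem MulAction.index_stabilizer_inf {M α : Type*} [Group M] [MulAction M α] (a b : α) :
    (stabilizer M b ⊓ stabilizer M a).index =
      (orbit M a).ncard * (orbit (stabilizer M a) b).ncard := by
  rw [← index_stabilizer, ← index_stabilizer, ← Subgroup.relIndex_mul_index inf_le_right,
    Subgroup.inf_relIndex_right, mul_comm]
  rfl

theorem mem_pairSetMap_mk {V : Type*} (σ : Equiv.Perm V) (S : Set (Sym2 V)) (a b : V) :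
    s(σ a, σ b) ∈ pairSetMap σ S ↔ s(a, b) ∈ S :=
  (Sym2.map.injective σ.injective).mem_set_image (a := s(a, b))

theorem mem_autSet_iff_pairSetMap_eq {V : Type*} (G : SimpleGraph V) (σ : Equiv.Perm V) :
    σ ∈ autSet G ↔ pairSetMap σ G.edgeSet = G.edgeSet := by
  constructor
  · intro h
    ext e
    induction e with
    | h x y =>
      obtain ⟨a, rfl⟩ := σ.surjective x
      obtain ⟨b, rfl⟩ := σ.surjective y
      rw [mem_pairSetMap_mk]
      exact h a b
  · intro h a b
    rw [← G.mem_edgeSet, ← G.mem_edgeSet, ← mem_pairSetMap_mk σ, h]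

theorem pairSetMap_diff {V : Type*} (σ : Equiv.Perm V) (S T : Set (Sym2 V)) :
    pairSetMap σ (S \ T) = pairSetMap σ S \ pairSetMap σ T :=
  Set.image_sdiff (Sym2.map.injective σ.injective) S T

theorem pairSetMap_union {V : Type*} (σ : Equiv.Perm V) (S T : Set (Sym2 V)) :
    pairSetMap σ (S ∪ T) = pairSetMap σ S ∪ pairSetMap σ T :=
  Set.image_union _ S T

theorem setOf_isoEdgeSet_eq_orbit {V : Type*} (G : SimpleGraph V) :
    {F : Set (Sym2 V) | (∀ e ∈ F, ¬ e.IsDiag) ∧ isIsoEdgeSet G F} =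
      letI := pairSetMulAction V
      MulAction.orbit (Equiv.Perm V) G.edgeSet := by
  ext F
  constructor
  · exact And.right
  · rintro ⟨σ, rfl⟩
    refine ⟨?_, σ, rfl⟩
    rintro _ ⟨e, he, rfl⟩
    rw [Sym2.isDiag_map σ.injective]
    exact G.not_isDiag_of_mem_edgeSet he

theorem edgeSetOrbit_eq_orbit {V : Type*} (G : SimpleGraph V) (S : Set (Sym2 V)) :
    edgeSetOrbit G S =
      letI := pairSetMulAction V
      MulAction.orbit (MulAction.stabilizer (Equiv.Perm V) G.edgeSet) S := by
  ext T
  constructor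
  · rintro ⟨σ, hσ, rfl⟩
    exact ⟨⟨σ, (mem_autSet_iff_pairSetMap_eq G σ).1 hσ⟩, rfl⟩
  · rintro ⟨⟨σ, hσ⟩, rfl⟩
    exact ⟨σ, (mem_autSet_iff_pairSetMap_eq G σ).2 hσ, rfl⟩

/-- Let `G = (V, E)` be a finite simple graph and `E' ⊆ E`. With `N(G)` the
number of edge sets `F` on `V` with `(V, F) ≅ G`, and `N(G − E')` the number of edge sets `F'`
on `V` with `(V, F') ≅ G − E'`, we have
`N(G) · |AO_G(E')| = N(G − E') · |AO_{G−E'}(E')|`. -/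
theorem card_isoEdgeSets_mul_orbit_eq {V : Type*} [Fintype V]
    (G : SimpleGraph V) (E' : Set (Sym2 V)) (hsub : E' ⊆ G.edgeSet) :
    {F : Set (Sym2 V) | (∀ e ∈ F, ¬ e.IsDiag) ∧ isIsoEdgeSet G F}.ncard *
        (edgeSetOrbit G E').ncard =
      {F' : Set (Sym2 V) | (∀ e ∈ F', ¬ e.IsDiag) ∧ isIsoEdgeSet (G.deleteEdges E') F'}.ncard *
        (edgeSetOrbit (G.deleteEdges E') E').ncard := by
  let := pairSetMulAction V
  rw [setOf_isoEdgeSet_eq_orbit, setOf_isoEdgeSet_eq_orbit, edgeSetOrbit_eq_orbit,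
    edgeSetOrbit_eq_orbit, ← MulAction.index_stabilizer_inf, ← MulAction.index_stabilizer_inf,
    SimpleGraph.edgeSet_deleteEdges]
  congr 1
  ext σ
  change pairSetMap σ E' = E' ∧ pairSetMap σ G.edgeSet = G.edgeSet ↔
    pairSetMap σ E' = E' ∧ pairSetMap σ (G.edgeSet \ E') = G.edgeSet \ E'
  refine and_congr_right fun hE => ⟨fun h => by rw [pairSetMap_diff, h, hE], fun h => ?_⟩
  rw [← Set.sdiff_union_of_subset hsub, pairSetMap_union, h, hE]
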